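/- With notation as in the jumping-polynomial construction: suppose k ∈ ℕ, A ∈ ℕ₀^k (supported on indices where the P-sequence is defined) and σ = Σ_{j=1}^k a_jβ_j. Then there exist B ∈ ℕ₀^k, θ ∈ 𝐤 and f ∈ 𝒜⁺_σ such that Σ_{j=1}^k b_jβ_j = σ, (B, 0̄) is irreducible with respect to 𝒯, and P^A = θP^B + f in R. -/

import Mathlib

/-! Core combinatorial definitions for the jumping-polynomial construction. -/

namespace Jump

/-- Tuples of nonnegative integers, indexed by positive integers (index 0 unused). -/
abbrev Vec := ℕ → ℕ

/-- Pairs of tuples. -/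
abbrev PVec := Vec × Vec

/-- `A` is a tuple in `ℕ₀^k` (entries indexed by `1, …, k`). -/
def Supp (k : ℕ) (A : Vec) : Prop := ∀ j : ℕ, (j = 0 ∨ k < j) → A j = 0

/-- `A` is a tuple in `ℤ^k` (entries indexed by `1, …, k`). -/
def SuppZ (k : ℕ) (A : ℕ → ℤ) : Prop := ∀ j : ℕ, (j = 0 ∨ k < j) → A j = 0

/-- `(A, C)` is irreducible with respect to a set `T` of pairs of tuples: no member of `T`
is componentwise less than or equal to `(A, C)`. -/
def Irr (T : Set PVec) (p : PVec) : Prop := ∀ bd ∈ T, ¬ (bd.1 ≤ p.1 ∧ bd.2 ≤ p.2)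

/-- The weight `A·β(k) = a₁β₁ + ⋯ + a_kβ_k` of a tuple of nonnegative integers. -/
noncomputable def wtA (β : ℕ → ℝ) (k : ℕ) (A : Vec) : ℝ :=
  ∑ j ∈ Finset.Icc 1 k, (A j : ℝ) * β j

/-- The weight of a tuple of integers. -/
noncomputable def wtZ (β : ℕ → ℝ) (k : ℕ) (A : ℕ → ℤ) : ℝ :=
  ∑ j ∈ Finset.Icc 1 k, (A j : ℝ) * β j

/-- The weight `|(A, C)| = A·β(k) + C·γ(i)` of a pair of tuples. -/
noncomputable def wt (β γ : ℕ → ℝ) (k i : ℕ) (p : PVec) : ℝ :=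
  wtA β k p.1 + wtA γ i p.2

/-- The group `G_n = β₁ℤ + ⋯ + β_nℤ` (as a subset of `ℝ`; `G_0 = {0}`). -/
noncomputable def Gr (β : ℕ → ℝ) (n : ℕ) : Set ℝ :=
  {t | ∃ A : ℕ → ℤ, SuppZ n A ∧ t = wtZ β n A}

/-- The semigroup `S_n = β₁ℕ₀ + ⋯ + β_nℕ₀` (as a subset of `ℝ`; `S_0 = {0}`). -/
noncomputable def Sg (β : ℕ → ℝ) (n : ℕ) : Set ℝ :=
  {t | ∃ A : Vec, Supp n A ∧ t = wtA β n A}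

/-- The set `G_k + H_i`. -/
noncomputable def GrH (β γ : ℕ → ℝ) (k i : ℕ) : Set ℝ :=
  {t | ∃ a ∈ Gr β k, ∃ b ∈ Gr γ i, t = a + b}

/-- The set `G + H_i`, where `G = ⋃_{n ≤ len} G_n`. -/
noncomputable def GH (β γ : ℕ → ℝ) (len : ℕ∞) (i : ℕ) : Set ℝ :=
  {t | ∃ k : ℕ, (k : ℕ∞) ≤ len ∧ t ∈ GrH β γ k i}

/-- The set `S_k + U_i`. -/
noncomputable def SU (β γ : ℕ → ℝ) (k i : ℕ) : Set ℝ :=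
  {t | ∃ a ∈ Sg β k, ∃ b ∈ Sg γ i, t = a + b}

/-- The `j`-th standard basis vector `E_j`. -/
def unitVec (j : ℕ) : Vec := fun l => if l = j then 1 else 0

/-- The set `𝒫 = {(q_jE_j, 0̄) : j ≥ 2, q_j < ∞}`. -/
def Pset (q : ℕ → ℕ∞) : Set PVec :=
  {p | ∃ j : ℕ, 2 ≤ j ∧ ∃ t : ℕ, q j = (t : ℕ∞) ∧
        p = (fun l => t * unitVec j l, fun _ => 0)}

/-- `(A, C) ∈ ℕ₀^{m_i} × ℕ₀^i` pushes `γ_i`: `c_i > 0` and `|(A, C)| ∈ S_{m_i} + U_{i-1}`. -/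
noncomputable def Push (β γ : ℕ → ℝ) (mi i : ℕ) (p : PVec) : Prop :=
  0 < p.2 i ∧ wt β γ mi i p ∈ SU β γ mi (i - 1)

/-- `(A, C)` is reduced: it pushes `γ_i` and no pair strictly below it (componentwise) does. -/
noncomputable def Red (β γ : ℕ → ℝ) (mi i : ℕ) (p : PVec) : Prop :=
  Push β γ mi i p ∧
    ∀ p' : PVec, p'.1 ≤ p.1 → p'.2 ≤ p.2 → p' ≠ p → ¬ Push β γ mi i p'

/-- The set `𝒟_i`, built from `𝒯_i`: empty if `s_i = ∞`, otherwise the pairs in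
`ℕ₀^{m_i} × ℕ₀^i` that are irreducible with respect to `𝒯_i` and reduced. -/
noncomputable def Dstep (β γ : ℕ → ℝ) (s : ℕ → ℕ∞) (m : ℕ → ℕ) (i : ℕ)
    (Ti : Set PVec) : Set PVec :=
  if s i = ⊤ then ∅ else
    {p | Supp (m i) p.1 ∧ Supp i p.2 ∧ Irr Ti p ∧ Red β γ (m i) i p}

/-- The chain `𝒯_1 = 𝒫`, `𝒯_{i+1} = 𝒯_i ∪ 𝒟_i` (here `Tchain 0 = Tchain 1 = 𝒫`,
which is forced by the convention `s 0 = ⊤`). -/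
noncomputable def Tchain (β γ : ℕ → ℝ) (q s : ℕ → ℕ∞) (m : ℕ → ℕ) : ℕ → Set PVec
  | 0 => Pset q
  | n + 1 => Tchain β γ q s m n ∪ Dstep β γ s m n (Tchain β γ q s m n)

/-- The set `𝒯 = ⋃_i 𝒯_i`. -/
noncomputable def Tfull (β γ : ℕ → ℝ) (q s : ℕ → ℕ∞) (m : ℕ → ℕ) : Set PVec :=
  ⋃ n, Tchain β γ q s m n

/-- A tuple `A ∈ ℤ^k` is permissible: `0 ≤ a_j < q_j` for all `1 ≤ j ≤ k` with `q_j < ∞`. -/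
def PermZ (q : ℕ → ℕ∞) (k : ℕ) (A : ℕ → ℤ) : Prop :=
  ∀ j : ℕ, 1 ≤ j → j ≤ k → ∀ t : ℕ, q j = (t : ℕ∞) → 0 ≤ A j ∧ A j < (t : ℤ)

/-- A tuple `A ∈ ℕ₀^k` is permissible: `a_j < q_j` for all `1 ≤ j ≤ k` with `q_j < ∞`. -/
def PermN (q : ℕ → ℕ∞) (k : ℕ) (A : Vec) : Prop :=
  ∀ j : ℕ, 1 ≤ j → j ≤ k → ∀ t : ℕ, q j = (t : ℕ∞) → A j < t

/-- The abstract combinatorial setup of the jumping-polynomial construction: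
a finite (of length `len`) or infinite (`len = ⊤`) sequence `β` of positive reals,
a sequence `γ` of nonnegative reals, and the derived data `q_j`, `s_i`, `m_i`
defined by their minimality properties. -/
structure Setup where
  /-- the length of the `β`-sequence (possibly `∞`) -/
  len : ℕ∞
  β : ℕ → ℝ
  γ : ℕ → ℝ
  q : ℕ → ℕ∞
  s : ℕ → ℕ∞
  m : ℕ → ℕ
  hlen : 2 ≤ len
  hβ : ∀ j : ℕ, 1 ≤ j → (j : ℕ∞) ≤ len → 0 < β j
  hγ : ∀ i : ℕ, 1 ≤ i → 0 ≤ γ i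
  hq1 : q 1 = ⊤
  hqtop : ∀ j : ℕ, len < (j : ℕ∞) → q j = ⊤
  hq : ∀ j : ℕ, 2 ≤ j → (j : ℕ∞) ≤ len →
    q j = sInf {x : ℕ∞ | ∃ t : ℕ, x = (t : ℕ∞) ∧ 0 < t ∧ (t : ℝ) * β j ∈ Gr β (j - 1)}
  /-- if `q_j = ∞` then `β_j` is the last term of the `β`-sequence, and conversely -/
  hlast : ∀ j : ℕ, 2 ≤ j → (j : ℕ∞) ≤ len → (q j = ⊤ ↔ len = (j : ℕ∞))
  /-- `β_{j+1} > q_jβ_j` whenever `q_j < ∞` -/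
  hgrow : ∀ j : ℕ, 2 ≤ j → (j : ℕ∞) ≤ len → ∀ t : ℕ, q j = (t : ℕ∞) →
    (t : ℝ) * β j < β (j + 1)
  hs0 : s 0 = ⊤
  hs : ∀ i : ℕ, 1 ≤ i →
    s i = sInf {x : ℕ∞ | ∃ t : ℕ, x = (t : ℕ∞) ∧ 0 < t ∧ (t : ℝ) * γ i ∈ GH β γ len (i - 1)}
  hm0 : m 0 = 1
  hmtop : ∀ i : ℕ, 1 ≤ i → s i = ⊤ → m i = m (i - 1)
  hmfin : ∀ i : ℕ, 1 ≤ i → ∀ t : ℕ, s i = (t : ℕ∞) →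
    m i = max (m (i - 1))
      (sInf {j : ℕ | 1 ≤ j ∧ (j : ℕ∞) ≤ len ∧ (t : ℝ) * γ i ∈ GrH β γ j (i - 1)})
  hmlen : ∀ i : ℕ, 1 ≤ m i ∧ ((m i : ℕ) : ℕ∞) ≤ len

end Jump

namespace Jump

open Classical in
/-- The added set at step `i` of the `𝒯`-chain in the full construction: `{(0̄, E_i)}` if
`T_i = 0`, and `𝒟_i` otherwise. -/
noncomputable def Astep (β γ : ℕ → ℝ) (s : ℕ → ℕ∞) (m : ℕ → ℕ) (Tz : ℕ → Prop)
    (i : ℕ) (Ti : Set PVec) : Set PVec :=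
  if i = 0 then ∅
  else if Tz i then {(fun _ => 0, unitVec i)}
  else Dstep β γ s m i Ti

open Classical in
/-- The set `𝒟_i` in the full construction: empty when `T_i = 0`. -/
noncomputable def DsetR (β γ : ℕ → ℝ) (s : ℕ → ℕ∞) (m : ℕ → ℕ) (Tz : ℕ → Prop)
    (i : ℕ) (Ti : Set PVec) : Set PVec :=
  if Tz i then ∅ else Dstep β γ s m i Ti

/-- The chain `𝒯_1 = 𝒫`, `𝒯_{i+1} = 𝒯_i ∪ 𝒟_i` (resp. `𝒯_{i+1} = 𝒯_i ∪ {(0̄, E_i)}` when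
`T_i = 0`) of the full construction. -/
noncomputable def TchainR (β γ : ℕ → ℝ) (q s : ℕ → ℕ∞) (m : ℕ → ℕ) (Tz : ℕ → Prop) :
    ℕ → Set PVec
  | 0 => Pset q
  | n + 1 => TchainR β γ q s m Tz n ∪ Astep β γ s m Tz n (TchainR β γ q s m Tz n)

/-- The set `𝒯 = ⋃_i 𝒯_i` of the full construction. -/
noncomputable def TfullR (β γ : ℕ → ℝ) (q s : ℕ → ℕ∞) (m : ℕ → ℕ) (Tz : ℕ → Prop) :
    Set PVec :=
  ⋃ n, TchainR β γ q s m Tz n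

/-- The full setting of the paper: `𝐤` a field, `K` an algebraic function field of
transcendence degree 3 over `𝐤`, `ν` a rank 1 `𝐤`-valuation of `K` (with real values,
written additively) with residue field `𝐤`, and `(R, m_R)` a 3-dimensional regular local
subring of `K` with quotient field `K`, dominated by `ν`, with regular parameters
`x, y, z` of increasing value; together with the sequences `{P_j}`, `{T_i}` of jumping
polynomials produced by the algorithm of Section 3, and all their associated data
(`β`, `γ`, `q`, `s`, `m`, `δ`, `𝒫`, `𝒟_i`, `𝒯_i`). -/
structure RSetup (K : Type) [Field K] where
  /-- the coefficient field `𝐤`, as a subfield of `K` -/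
  kk : Subfield K
  /-- the valuation, written additively -/
  ν : K → ℝ
  /-- the regular local ring `R` -/
  R : Subring K
  x : K
  y : K
  z : K
  /-- the length of the sequence `{P_j}` (possibly `∞`) -/
  len : ℕ∞
  P : ℕ → K
  T : ℕ → K
  β : ℕ → ℝ
  γ : ℕ → ℝ
  q : ℕ → ℕ∞
  s : ℕ → ℕ∞
  m : ℕ → ℕ
  δ : ℕ → ℕ
  -- `K` is an algebraic function field of transcendence degree 3 over `𝐤`:
  hfg : ∃ t : Finset K, Subfield.closure ((kk : Set K) ∪ (t : Set K)) = ⊤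
  htrdeg : ∃ sfn : Fin 3 → K,
    Function.Injective (MvPolynomial.eval₂Hom kk.subtype sfn) ∧
    ∀ a : K, ∃ p : Polynomial K, p ≠ 0 ∧
      (∀ n : ℕ, p.coeff n ∈ Subfield.closure ((kk : Set K) ∪ Set.range sfn)) ∧
      Polynomial.eval a p = 0
  -- `ν` is a rank 1 `𝐤`-valuation with residue field `𝐤`:
  hmul : ∀ f g : K, f ≠ 0 → g ≠ 0 → ν (f * g) = ν f + ν g
  hadd : ∀ f g : K, f ≠ 0 → g ≠ 0 → f + g ≠ 0 → min (ν f) (ν g) ≤ ν (f + g)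
  htriv : ∀ c : K, c ∈ kk → c ≠ 0 → ν c = 0
  hres : ∀ f : K, f ≠ 0 → 0 ≤ ν f → ∃ c ∈ kk, f - c = 0 ∨ 0 < ν (f - c)
  -- `R` is a local subring of `K` containing `𝐤`, with quotient field `K`,
  -- dominated by `ν`:
  hkR : (kk : Set K) ⊆ R
  hfrac : ∀ f : K, ∃ a b : K, a ∈ R ∧ b ∈ R ∧ b ≠ 0 ∧ f = a / b
  hdom : ∀ f ∈ R, f ≠ 0 → 0 ≤ ν f
  hloc : ∀ f ∈ R, f ≠ 0 → ν f = 0 → f⁻¹ ∈ R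
  -- `R` is regular of dimension 3 with regular parameters `x, y, z`, and
  -- `0 < ν(x) ≤ ν(y) ≤ ν(z)`:
  hx : x ∈ R
  hy : y ∈ R
  hz : z ∈ R
  hxne : x ≠ 0
  hyne : y ≠ 0
  hzne : z ≠ 0
  hνx : 0 < ν x
  hνxy : ν x ≤ ν y
  hνyz : ν y ≤ ν z
  hdim : ringKrullDim R = ((3 : ℕ) : WithBot ℕ∞)
  hparam : ∀ (f : K) (hf : f ∈ R), f ≠ 0 → 0 < ν f →
    (⟨f, hf⟩ : R) ∈ Ideal.span ({⟨x, hx⟩, ⟨y, hy⟩, ⟨z, hz⟩} : Set R)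
  -- the sequence `{P_j}` of jumping polynomials and its values `β_j = ν(P_j)`:
  hlen : 2 ≤ len
  hPmem : ∀ j : ℕ, 1 ≤ j → (j : ℕ∞) ≤ len → P j ∈ R
  hPne : ∀ j : ℕ, 1 ≤ j → (j : ℕ∞) ≤ len → P j ≠ 0
  hP1 : P 1 = x
  hP2 : P 2 = y
  hβ : ∀ j : ℕ, 1 ≤ j → (j : ℕ∞) ≤ len → β j = ν (P j)
  hq1 : q 1 = ⊤
  hqtop : ∀ j : ℕ, len < (j : ℕ∞) → q j = ⊤
  hq : ∀ j : ℕ, 2 ≤ j → (j : ℕ∞) ≤ len →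
    q j = sInf {u : ℕ∞ | ∃ t : ℕ, u = (t : ℕ∞) ∧ 0 < t ∧ (t : ℝ) * β j ∈ Gr β (j - 1)}
  /-- the sequence `{P_j}` ends at `P_j` exactly when `q_j = ∞` -/
  hlast : ∀ j : ℕ, 2 ≤ j → (j : ℕ∞) ≤ len → (q j = ⊤ ↔ len = (j : ℕ∞))
  /-- the recursion `P_{j+1} = P_j^{q_j} − λ_jP^{L(j)}`, where `(L(j), 0̄)` is irreducible
  with respect to `𝒫_j` with `q_jβ_j = L(j)·β(j−1)` and `λ_j ∈ 𝐤∖{0}` is the residue of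
  `P_j^{q_j}/P^{L(j)}` (so that `ν(P_{j+1}) > q_jβ_j`) -/
  hPrec : ∀ j : ℕ, 2 ≤ j → (j : ℕ∞) ≤ len → ∀ t : ℕ, q j = (t : ℕ∞) →
    ∃ (lam : K) (LL : Vec), lam ∈ kk ∧ lam ≠ 0 ∧ Supp (j - 1) LL ∧
      (∀ l : ℕ, 2 ≤ l → l ≤ j - 1 → ∀ u : ℕ, q l = (u : ℕ∞) → LL l < u) ∧
      (t : ℝ) * β j = wtA β (j - 1) LL ∧
      P (j + 1) = P j ^ t - lam * ∏ l ∈ Finset.Icc 1 (j - 1), P l ^ LL l ∧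
      (t : ℝ) * β j < ν (P (j + 1))
  -- the sequence `{T_i}` of jumping polynomials and its values `γ_i`:
  hTmem : ∀ i : ℕ, 1 ≤ i → T i ∈ R
  hT1 : T 1 = z
  hγ : ∀ i : ℕ, 1 ≤ i → (T i = 0 → γ i = 0) ∧ (T i ≠ 0 → γ i = ν (T i))
  hs0 : s 0 = ⊤
  hsz : ∀ i : ℕ, 1 ≤ i → T i = 0 → s i = 1 ∧ m i = m (i - 1)
  hs : ∀ i : ℕ, 1 ≤ i → T i ≠ 0 →
    s i = sInf {u : ℕ∞ | ∃ t : ℕ, u = (t : ℕ∞) ∧ 0 < t ∧ (t : ℝ) * γ i ∈ GH β γ len (i - 1)}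
  hm0 : m 0 = 1
  hmtop : ∀ i : ℕ, 1 ≤ i → T i ≠ 0 → s i = ⊤ → m i = m (i - 1)
  hmfin : ∀ i : ℕ, 1 ≤ i → T i ≠ 0 → ∀ t : ℕ, s i = (t : ℕ∞) →
    m i = max (m (i - 1))
      (sInf {j : ℕ | 1 ≤ j ∧ (j : ℕ∞) ≤ len ∧ (t : ℝ) * γ i ∈ GrH β γ j (i - 1)})
  hmlen : ∀ i : ℕ, 1 ≤ m i ∧ ((m i : ℕ) : ℕ∞) ≤ len
  -- `δ_i = #𝒟_i` (with `δ_0 = 1`):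
  hδ0 : δ 0 = 1
  hδ : ∀ i : ℕ, 1 ≤ i →
    (DsetR β γ s m (fun n => T n = 0) i
        (TchainR β γ q s m (fun n => T n = 0) i)).Finite ∧
    δ i = (DsetR β γ s m (fun n => T n = 0) i
        (TchainR β γ q s m (fun n => T n = 0) i)).ncard
  /-- the recursion for the `T`-sequence: for each `i` with `T_i ≠ 0` and `s_i < ∞`, the
  elements of `𝒟_i`, enumerated as `(A,C)_1, …, (A,C)_{δ_i}` in increasing order of
  `|(A,C)|`, give `T_{(Σ_{j=0}^{i-1}δ_j)+k} = T_{AC} = P^AT^C − μ_{AC}P^{L(AC)}T^{N(AC)}`,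
  where `(L(AC), N(AC)) ∈ ℕ₀^{m_i} × ℕ₀^{i-1}` is irreducible with respect to `𝒯_i` with
  `|(L(AC), N(AC))| = |(A,C)|` and `μ_{AC} ∈ 𝐤∖{0}` is the residue of
  `P^AT^C/(P^{L(AC)}T^{N(AC)})` (so that `ν(T_{AC}) > |(A,C)|` unless `T_{AC} = 0`) -/
  hTrec : ∀ i : ℕ, 1 ≤ i → T i ≠ 0 → s i ≠ ⊤ →
    ∃ e : ↥(DsetR β γ s m (fun n => T n = 0) i
        (TchainR β γ q s m (fun n => T n = 0) i)) ≃ Fin (δ i),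
      (∀ p p', ((e p : Fin (δ i)) : ℕ) ≤ ((e p' : Fin (δ i)) : ℕ) →
        wt β γ (m i) i p.1 ≤ wt β γ (m i) i p'.1) ∧
      ∀ p, ∃ (LL NN : Vec) (mu : K),
        Supp (m i) LL ∧ Supp (i - 1) NN ∧
        Irr (TchainR β γ q s m (fun n => T n = 0) i) (LL, NN) ∧
        wt β γ (m i) (i - 1) (LL, NN) = wt β γ (m i) i p.1 ∧
        mu ∈ kk ∧ mu ≠ 0 ∧
        T ((∑ j ∈ Finset.range i, δ j) + ((e p : Fin (δ i)) : ℕ) + 1) =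
          (∏ l ∈ Finset.Icc 1 (m i), P l ^ (p : PVec).1 l) *
            (∏ l ∈ Finset.Icc 1 i, T l ^ (p : PVec).2 l) -
          mu * (∏ l ∈ Finset.Icc 1 (m i), P l ^ LL l) *
            (∏ l ∈ Finset.Icc 1 (i - 1), T l ^ NN l) ∧
        (T ((∑ j ∈ Finset.range i, δ j) + ((e p : Fin (δ i)) : ℕ) + 1) = 0 ∨
          wt β γ (m i) i p.1 <
            ν (T ((∑ j ∈ Finset.range i, δ j) + ((e p : Fin (δ i)) : ℕ) + 1)))

namespace RSetup

variable {K : Type} [Field K] (d : RSetup K)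

/-- The monomial `P^A = ∏_{l=1}^{k} P_l^{a_l}`. -/
noncomputable def Pm (k : ℕ) (A : Vec) : K := ∏ l ∈ Finset.Icc 1 k, d.P l ^ A l

/-- The monomial `T^C = ∏_{l=1}^{i} T_l^{c_l}`. -/
noncomputable def Tm (i : ℕ) (C : Vec) : K := ∏ l ∈ Finset.Icc 1 i, d.T l ^ C l

/-- The set `𝒯 = ⋃_i 𝒯_i` of the construction. -/
noncomputable def TF : Set PVec :=
  TfullR d.β d.γ d.q d.s d.m (fun n => d.T n = 0)

/-- The value semigroup `S_R = ν(R∖{0})`. -/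
def SR : Set ℝ := {t : ℝ | ∃ f : K, f ∈ d.R ∧ f ≠ 0 ∧ d.ν f = t}

/-- The valuation ideal `I_σ = {f ∈ R : ν(f) ≥ σ}` (as a subset of `K`). -/
def Iv (σ : ℝ) : Set K := {f : K | f ∈ d.R ∧ (f = 0 ∨ σ ≤ d.ν f)}

/-- The ideal `𝒜_σ` of `R` generated by the monomials `P^AT^C` with `|(A, C)| ≥ σ`
(as a subset of `K`). -/
noncomputable def Av (σ : ℝ) : Set K :=
  {f : K | ∃ (M : ℕ) (g : Fin M → K) (kb ib : Fin M → ℕ) (A C : Fin M → Vec),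
    (∀ e, g e ∈ d.R) ∧ (∀ e, ((kb e : ℕ) : ℕ∞) ≤ d.len) ∧
    (∀ e, Supp (kb e) (A e)) ∧ (∀ e, Supp (ib e) (C e)) ∧
    (∀ e, σ ≤ wt d.β d.γ (kb e) (ib e) (A e, C e)) ∧
    f = ∑ e, g e * (d.Pm (kb e) (A e) * d.Tm (ib e) (C e))}

/-- The ideal `𝒜⁺_σ` of `R` generated by the monomials `P^AT^C` with `|(A, C)| > σ`
(as a subset of `K`). -/
noncomputable def Avplus (σ : ℝ) : Set K :=
  {f : K | ∃ (M : ℕ) (g : Fin M → K) (kb ib : Fin M → ℕ) (A C : Fin M → Vec),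
    (∀ e, g e ∈ d.R) ∧ (∀ e, ((kb e : ℕ) : ℕ∞) ≤ d.len) ∧
    (∀ e, Supp (kb e) (A e)) ∧ (∀ e, Supp (ib e) (C e)) ∧
    (∀ e, σ < wt d.β d.γ (kb e) (ib e) (A e, C e)) ∧
    f = ∑ e, g e * (d.Pm (kb e) (A e) * d.Tm (ib e) (C e))}

end RSetup

end Jump

namespace Jump

theorem wtA_add (β : ℕ → ℝ) (k : ℕ) (A B : Vec) :
    wtA β k (A + B) = wtA β k A + wtA β k B := by
  simp [wtA, add_mul, Finset.sum_add_distrib]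

theorem wtA_smul_unitVec (β : ℕ → ℝ) {k j : ℕ} (h1 : 1 ≤ j) (hj : j ≤ k) (t : ℕ) :
    wtA β k (t • unitVec j) = t * β j := by
  rw [wtA, Finset.sum_eq_single j]
  · simp [unitVec]
  · intro l _ hl
    simp [unitVec, hl]
  · simp [h1, hj]

theorem wtA_eq_of_le (β : ℕ → ℝ) {k k' : ℕ} (h : k ≤ k') {A : Vec} (hA : Supp k A) :
    wtA β k' A = wtA β k A := by
  refine (Finset.sum_subset (Finset.Icc_subset_Icc le_rfl h) fun l hl hl' => ?_).symm
  have : A l = 0 := hA l (by simp at hl hl'; omega)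
  simp [this]

theorem Supp.mono {k k' : ℕ} (h : k ≤ k') {A : Vec} (hA : Supp k A) : Supp k' A :=
  fun j hj => hA j (by omega)

theorem Supp.add {k : ℕ} {A B : Vec} (hA : Supp k A) (hB : Supp k B) : Supp k (A + B) :=
  fun j hj => by simp [hA j hj, hB j hj]

theorem Supp.sub {k : ℕ} {A : Vec} (hA : Supp k A) (B : Vec) : Supp k (A - B) :=
  fun j hj => by simp [hA j hj]

theorem supp_smul_unitVec {k j : ℕ} (h1 : 1 ≤ j) (hj : j ≤ k) (t : ℕ) :
    Supp k (t • unitVec j) := fun l hl => by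
  have : l ≠ j := by omega
  simp [unitVec, this]

theorem smul_unitVec_le {A : Vec} {j t : ℕ} (h : t ≤ A j) : t • unitVec j ≤ A := fun l => by
  by_cases hl : l = j
  · subst hl; simpa [unitVec] using h
  · simp [unitVec, hl]

namespace RSetup

variable {K : Type} [Field K] (d : RSetup K)

theorem Pm_add (k : ℕ) (A B : Vec) : d.Pm k (A + B) = d.Pm k A * d.Pm k B := by
  simp [Pm, pow_add, Finset.prod_mul_distrib]

theorem Pm_smul_unitVec {k j : ℕ} (h1 : 1 ≤ j) (hj : j ≤ k) (t : ℕ) :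
    d.Pm k (t • unitVec j) = d.P j ^ t := by
  rw [Pm, Finset.prod_eq_single j]
  · simp [unitVec]
  · intro l _ hl
    simp [unitVec, hl]
  · simp [h1, hj]

theorem Pm_eq_of_le {k k' : ℕ} (h : k ≤ k') {A : Vec} (hA : Supp k A) :
    d.Pm k' A = d.Pm k A := by
  refine (Finset.prod_subset (Finset.Icc_subset_Icc le_rfl h) fun l hl hl' => ?_).symm
  have : A l = 0 := hA l (by simp at hl hl'; omega)
  simp [this]

theorem zero_mem_Avplus (σ : ℝ) : (0 : K) ∈ d.Avplus σ :=
  ⟨0, 0, 0, 0, 0, 0, by simp⟩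

theorem Avplus_add {σ : ℝ} {f g : K} (hf : f ∈ d.Avplus σ) (hg : g ∈ d.Avplus σ) :
    f + g ∈ d.Avplus σ := by
  obtain ⟨M, c, kb, ib, A, C, hc, hk, hA, hC, hw, rfl⟩ := hf
  obtain ⟨M', c', kb', ib', A', C', hc', hk', hA', hC', hw', rfl⟩ := hg
  refine ⟨M + M', Fin.append c c', Fin.append kb kb', Fin.append ib ib', Fin.append A A',
    Fin.append C C', ?_, ?_, ?_, ?_, ?_, ?_⟩
  · exact Fin.addCases (by simpa using hc) (by simpa using hc')
  · exact Fin.addCases (by simpa using hk) (by simpa using hk')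
  · exact Fin.addCases (by simpa using hA) (by simpa using hA')
  · exact Fin.addCases (by simpa using hC) (by simpa using hC')
  · exact Fin.addCases (by simpa using hw) (by simpa using hw')
  · simp [Fin.sum_univ_add]

theorem Avplus_mul {σ : ℝ} {c f : K} (hc : c ∈ d.R) (hf : f ∈ d.Avplus σ) :
    c * f ∈ d.Avplus σ := by
  obtain ⟨M, g, kb, ib, A, C, hg, hk, hA, hC, hw, rfl⟩ := hf
  exact ⟨M, fun e => c * g e, kb, ib, A, C, fun e => d.R.mul_mem hc (hg e), hk, hA, hC, hw,
    by simp [Finset.mul_sum, mul_assoc]⟩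

theorem Pm_mem_Avplus {σ : ℝ} {k : ℕ} (hk : (k : ℕ∞) ≤ d.len) {A : Vec} (hA : Supp k A)
    (hσ : σ < wtA d.β k A) : d.Pm k A ∈ d.Avplus σ :=
  ⟨1, fun _ => 1, fun _ => k, fun _ => 0, fun _ => A, fun _ => 0, fun _ => d.R.one_mem,
    fun _ => hk, fun _ => hA, fun _ _ _ => rfl,
    fun _ => by simpa [wt, wtA] using hσ, by simp [Tm]⟩

theorem q_pos {j t : ℕ} (h2 : 2 ≤ j) (ht : d.q j = t) : 0 < t := by
  have hj : (j : ℕ∞) ≤ d.len := by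
    by_contra h
    simp [d.hqtop j (not_le.1 h)] at ht
  rw [d.hq j h2 hj] at ht
  have hne : {u : ℕ∞ | ∃ t : ℕ, u = (t : ℕ∞) ∧ 0 < t ∧
      (t : ℝ) * d.β j ∈ Gr d.β (j - 1)}.Nonempty := by
    by_contra h
    simp [Set.not_nonempty_iff_eq_empty.1 h] at ht
  obtain ⟨u, hu, hpos, -⟩ := csInf_mem hne
  rw [ht] at hu
  rwa [Nat.cast_inj.1 hu]

theorem mem_Pset_or_snd_pos {n : ℕ} {p : PVec}
    (hp : p ∈ TchainR d.β d.γ d.q d.s d.m (fun n => d.T n = 0) n) :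
    p ∈ Pset d.q ∨ ∃ i, 0 < p.2 i := by
  induction n with
  | zero => exact Or.inl hp
  | succ n ih =>
    rcases hp with hp | hp
    · exact ih hp
    · right
      unfold Astep at hp
      split_ifs at hp
      · exact hp.elim
      · rw [Set.mem_singleton_iff] at hp
        exact ⟨n, by simp [hp, unitVec]⟩
      · unfold Dstep at hp
        split_ifs at hp
        · exact hp.elim
        · exact ⟨n, hp.2.2.2.1.1⟩

theorem irr_TF_of_lt {B : Vec}
    (hB : ∀ j, 2 ≤ j → ∀ t : ℕ, d.q j = t → B j < t) : Irr d.TF (B, fun _ => 0) := by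
  rintro p hp ⟨h1, h2⟩
  obtain ⟨n, hn⟩ := Set.mem_iUnion.1 hp
  rcases d.mem_Pset_or_snd_pos hn with ⟨j, hj, t, ht, rfl⟩ | ⟨i, hi⟩
  · have := h1 j
    simp only [unitVec, if_true, mul_one] at this
    exact absurd (hB j hj t ht) (not_lt.2 this)
  · exact absurd (h2 i) (not_le.2 hi)

/-- Replacing `P_j^{q_j}` by `P_{j+1} + λ_jP^{L(j)}` in a monomial. -/
theorem Pm_reduce {k j t : ℕ} (hkl : (k : ℕ∞) ≤ d.len) (h2 : 2 ≤ j) (hjk : j ≤ k)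
    (ht : d.q j = t) {A : Vec} (hA : Supp k A) (hAj : t ≤ A j) :
    ∃ (A' : Vec) (lam f : K), Supp k A' ∧ (∀ l, j < l → A' l = A l) ∧ A' j < A j ∧
      lam ∈ d.kk ∧ f ∈ d.Avplus (wtA d.β k A) ∧ wtA d.β k A' = wtA d.β k A ∧
      d.Pm k A = lam * d.Pm k A' + f := by
  have hjl : (j : ℕ∞) ≤ d.len := le_trans (by exact_mod_cast hjk) hkl
  have hlt : (j : ℕ∞) < d.len := lt_of_le_of_ne hjl fun h => by
    simp [(d.hlast j h2 hjl).2 h.symm] at ht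
  have hjl' : ((j + 1 : ℕ) : ℕ∞) ≤ d.len := by
    exact_mod_cast Order.add_one_le_of_lt hlt
  obtain ⟨lam, L, hlam, -, hL, -, hwL, hP, hν⟩ := d.hPrec j h2 hjl t ht
  rw [← d.hβ (j + 1) (by omega) hjl'] at hν
  have hq := d.q_pos h2 ht
  obtain ⟨D, hD⟩ : ∃ D, D = A - t • unitVec j := ⟨_, rfl⟩
  have hAD : A = D + t • unitVec j := by
    rw [hD, tsub_add_cancel_of_le (smul_unitVec_le hAj)]
  have hDs : Supp k D := hD ▸ hA.sub _
  have hLk : Supp k L := hL.mono (by omega)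
  have hAj' : A j = D j + t := by rw [hAD]; simp [unitVec]
  have hwA : wtA d.β k A = wtA d.β k D + t * d.β j := by
    rw [hAD, wtA_add, wtA_smul_unitVec _ (by omega) hjk]
  have hkm : k ≤ max k (j + 1) := le_max_left _ _
  have hjm : j + 1 ≤ max k (j + 1) := le_max_right _ _
  refine ⟨D + L, lam, d.Pm (max k (j + 1)) (D + 1 • unitVec (j + 1)), hDs.add hLk, ?_, ?_,
    hlam, ?_, ?_, ?_⟩
  · intro l hl
    have : l ≠ j := by omega
    simp [hAD, hL l (by omega), unitVec, this]
  · have : L j = 0 := hL j (by omega)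
    simp only [Pi.add_apply, this]
    omega
  · refine d.Pm_mem_Avplus ?_ ((hDs.mono hkm).add (supp_smul_unitVec (by omega) hjm 1)) ?_
    · rcases max_choice k (j + 1) with h | h <;> rw [h] <;> assumption
    · rw [wtA_add, wtA_smul_unitVec _ (by omega) hjm, wtA_eq_of_le _ hkm hDs, hwA]
      simpa using hν
  · rw [wtA_add, hwA, wtA_eq_of_le _ (by omega) hL, hwL]
  · have hP' : d.P (j + 1) = d.P j ^ t - lam * d.Pm (j - 1) L := hP
    rw [Pm_add, Pm_add, Pm_smul_unitVec _ (by omega) hjm, d.Pm_eq_of_le hkm hDs,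
      d.Pm_eq_of_le (by omega) hL, hAD, Pm_add, Pm_smul_unitVec _ (by omega) hjk, pow_one, hP']
    ring

theorem exists_reduction_of_lt {k : ℕ} (hkl : (k : ℕ∞) ≤ d.len) (n : ℕ) (hn : n ≤ k)
    (A : Vec) (hA : Supp k A)
    (hAq : ∀ j, n < j → 2 ≤ j → ∀ t : ℕ, d.q j = t → A j < t) :
    ∃ (B : Vec) (θ f : K),
      Supp k B ∧ θ ∈ d.kk ∧ f ∈ d.Avplus (wtA d.β k A) ∧
      wtA d.β k B = wtA d.β k A ∧ Irr d.TF (B, fun _ => 0) ∧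
      d.Pm k A = θ * d.Pm k B + f := by
  induction n generalizing A with
  | zero =>
    exact ⟨A, 1, 0, hA, d.kk.one_mem, d.zero_mem_Avplus _, rfl,
      d.irr_TF_of_lt fun j hj => hAq j (by omega) hj, by simp⟩
  | succ n ih =>
    induction h : A (n + 1) using Nat.strong_induction_on generalizing A with
    | _ a iha =>
      subst h
      by_cases hlt : ∀ t : ℕ, 2 ≤ n + 1 → d.q (n + 1) = t → A (n + 1) < t
      · refine ih (by omega) A hA fun j hj h2 t ht => ?_
        rcases Nat.lt_or_ge (n + 1) j with h | h
        · exact hAq j h h2 t ht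
        · obtain rfl : j = n + 1 := by omega
          exact hlt t h2 ht
      · push Not at hlt
        obtain ⟨t, h2, ht, hle⟩ := hlt
        obtain ⟨A', lam, f, hA', hAA', hlt', hlam, hf, hw, hP⟩ :=
          d.Pm_reduce hkl h2 hn ht hA hle
        obtain ⟨B, θ, g, hB, hθ, hg, hwB, hirr, hPB⟩ :=
          iha _ hlt' A' hA' (fun j hj => hAA' j hj ▸ hAq j hj) rfl
        refine ⟨B, lam * θ, lam * g + f, hB, d.kk.mul_mem hlam hθ,
          d.Avplus_add (d.Avplus_mul (d.hkR hlam) (hw ▸ hg)) hf, hwB.trans hw, hirr, ?_⟩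
        rw [hP, hPB]
        ring

end RSetup

/-- Lemma 5.1. For `A ∈ ℕ₀^k` and `σ = A·β(k)`, there exist
`B ∈ ℕ₀^k`, `θ ∈ 𝐤` and `f ∈ 𝒜⁺_σ` such that `B·β(k) = σ`, `(B, 0̄)` is irreducible
with respect to `𝒯`, and `P^A = θP^B + f` in `R`. -/
theorem P_monomial_reduction {K : Type} [Field K] (d : RSetup K) (k : ℕ)
    (hk : 1 ≤ k) (hkl : (k : ℕ∞) ≤ d.len) (A : Vec) (hA : Supp k A) :
    ∃ (B : Vec) (θ f : K),
      Supp k B ∧ θ ∈ d.kk ∧ f ∈ d.Avplus (wtA d.β k A) ∧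
      wtA d.β k B = wtA d.β k A ∧
      Irr d.TF (B, fun _ => 0) ∧
      d.Pm k A = θ * d.Pm k B + f := by
  exact d.exists_reduction_of_lt hkl k le_rfl A hA fun j hj h2 t ht => by
    rw [hA j (Or.inr hj)]
    exact d.q_pos h2 ht

end Jump
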